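/- For a tetrahedron of flags, the edge coordinates at a fixed vertex i satisfy z_ik = 1/(1 − z_ij) and z_il = 1 − 1/z_ij, where (i,j,k,l) is an even permutation of (1,2,3,4); in particular z_ij · z_ik · z_il = −1. -/

import Mathlib

/-- The determinant of three vectors of `K³` w.r.t. the canonical basis. -/
def det3 {K : Type*} [Field K] (a b c : Fin 3 → K) : K :=
  Matrix.det (Matrix.of ![a, b, c])

/-- A generic configuration of (affine) flags `(xᵢ, fᵢ)`: each `fᵢ` vanishes on `xᵢ`,
the points are in general position (any three of the `xᵢ` are linearly independent),
and `f j (x i) ≠ 0` for `i ≠ j`. -/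
structure IsGenericConfig {K : Type*} [Field K] {ι : Type*}
    (x : ι → Fin 3 → K) (f : ι → Module.Dual K (Fin 3 → K)) : Prop where
  flag : ∀ i, f i (x i) = 0
  pos : ∀ i j l, i ≠ j → i ≠ l → j ≠ l → det3 (x i) (x j) (x l) ≠ 0
  nondeg : ∀ i j, i ≠ j → f j (x i) ≠ 0

/-- The edge coordinate `z_ij = f_i(x_k)·det(x_i,x_j,x_l) / (f_i(x_l)·det(x_i,x_j,x_k))`
of a tetrahedron of flags, for `(i,j,k,l)` an even permutation of the four vertices. -/
def zEdge {K : Type*} [Field K] (x : Fin 4 → Fin 3 → K)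
    (f : Fin 4 → Module.Dual K (Fin 3 → K)) (i j k l : Fin 4) : K :=
  f i (x k) * det3 (x i) (x j) (x l) / (f i (x l) * det3 (x i) (x j) (x k))

/-- The triple ratio `z_ijk = f_i(x_j)f_j(x_k)f_k(x_i)/(f_i(x_k)f_j(x_i)f_k(x_j))`. -/
def zFace {K : Type*} [Field K] {ι : Type*} (x : ι → Fin 3 → K)
    (f : ι → Module.Dual K (Fin 3 → K)) (i j k : ι) : K :=
  f i (x j) * f j (x k) * f k (x i) / (f i (x k) * f j (x i) * f k (x j))

theorem det3_swap {K : Type*} [Field K] (a b c : Fin 3 → K) : det3 a c b = - det3 a b c := by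
  simp [det3, Matrix.det_fin_three]
  ring

theorem det3_rel {K : Type*} [Field K] (a b c d : Fin 3 → K) :
    det3 a c d • b - det3 a b d • c + det3 a b c • d = det3 b c d • a := by
  ext n
  fin_cases n <;> simp [det3, Matrix.det_fin_three] <;> ring

theorem det3_dual_rel {K : Type*} [Field K] (f : Module.Dual K (Fin 3 → K))
    (a b c d : Fin 3 → K) (h : f a = 0) :
    f d * det3 a b c - f c * det3 a b d = - (f b * det3 a c d) := by
  have := congrArg f (det3_rel a b c d)
  simp only [map_add, map_sub, map_smul, h, smul_eq_mul] at this
  linear_combination this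

theorem rel_aux {K : Type*} [Field K] (Fj Fk Fl A B C : K) (hj : Fj ≠ 0) (hk : Fk ≠ 0)
    (hl : Fl ≠ 0) (hA : A ≠ 0) (hB : B ≠ 0) (hC : C ≠ 0)
    (h : Fl * A - Fk * B = - (Fj * C)) :
    Fl * -A / (Fj * C) = 1 / (1 - Fk * B / (Fl * A)) ∧
    Fj * -C / (Fk * -B) = 1 - 1 / (Fk * B / (Fl * A)) ∧
    Fk * B / (Fl * A) * (Fl * -A / (Fj * C)) * (Fj * -C / (Fk * -B)) = -1 := by
  refine ⟨?_, ?_, ?_⟩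
  · have e : 1 - Fk * B / (Fl * A) = - (Fj * C) / (Fl * A) := by
      rw [← h]; field_simp
    rw [e]; field_simp
  · rw [one_div_div]
    field_simp
    linear_combination h
  · field_simp

/-- For a generic tetrahedron of flags and every even permutation `(i,j,k,l)` of the
vertices, the edge coordinates at the vertex `i` satisfy `z_ik = 1/(1 − z_ij)` and
`z_il = 1 − 1/z_ij`; in particular `z_ij·z_ik·z_il = −1`. -/
theorem vertex_relations {K : Type*} [Field K]
    (x : Fin 4 → Fin 3 → K) (f : Fin 4 → Module.Dual K (Fin 3 → K))
    (hgen : IsGenericConfig x f)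
    (σ : Equiv.Perm (Fin 4)) (hσ : Equiv.Perm.sign σ = 1) :
    let i := σ 0; let j := σ 1; let k := σ 2; let l := σ 3
    zEdge x f i k l j = 1 / (1 - zEdge x f i j k l) ∧
    zEdge x f i l j k = 1 - 1 / zEdge x f i j k l ∧
    zEdge x f i j k l * zEdge x f i k l j * zEdge x f i l j k = -1 := by
  intro i j k l
  have n : ∀ a b : Fin 4, a ≠ b → σ a ≠ σ b := fun a b h => σ.injective.ne h
  have hij : i ≠ j := n 0 1 (by decide)
  have hik : i ≠ k := n 0 2 (by decide)
  have hil : i ≠ l := n 0 3 (by decide)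
  have hjk : j ≠ k := n 1 2 (by decide)
  have hjl : j ≠ l := n 1 3 (by decide)
  have hkl : k ≠ l := n 2 3 (by decide)
  unfold zEdge
  rw [det3_swap (x i) (x j) (x k), det3_swap (x i) (x k) (x l), det3_swap (x i) (x j) (x l)]
  exact rel_aux _ _ _ _ _ _ (hgen.nondeg _ _ hij.symm) (hgen.nondeg _ _ hik.symm)
    (hgen.nondeg _ _ hil.symm) (hgen.pos _ _ _ hij hik hjk) (hgen.pos _ _ _ hij hil hjl)
    (hgen.pos _ _ _ hik hil hkl) (det3_dual_rel _ _ _ _ _ (hgen.flag i))
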